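/- Let X be a proper metric space and m : X × X → X a conical midpoint assignment, i.e., d(x, m(x,y)) = d(m(x,y), y) = d(x,y)/2 for all x,y ∈ X, and d(m(x,y), m(x',y')) ≤ (1/2)·d(x,x') + (1/2)·d(y,y') for all x,y,x',y' ∈ X. Then X admits a symmetric conical midpoint assignment, i.e., a conical midpoint assignment □ : X × X → X that additionally satisfies □(x,y) = □(y,x) for all x,y ∈ X. (The value □(x,y) is the common limit of the sequences x_0=x, y_0=y, x_i = m(x_{i−1}, y_{i−1}), y_i = m(y_{i−1}, x_{i−1}).) -/

import Mathlib

/-- A conical midpoint assignment on a metric space `X`. -/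
def IsConicalMidpoint {X : Type*} [MetricSpace X] (m : X → X → X) : Prop :=
  (∀ x y : X, dist x (m x y) = dist x y / 2) ∧
  (∀ x y : X, dist (m x y) y = dist x y / 2) ∧
  (∀ x y x' y' : X, dist (m x y) (m x' y') ≤ (1 / 2) * dist x x' + (1 / 2) * dist y y')

/-- The pair of sequences `x_i, y_i` with `x_0 = x`, `y_0 = y`,
`x_i = m (x_{i-1}) (y_{i-1})`, `y_i = m (y_{i-1}) (x_{i-1})`. -/
def midSeq {X : Type*} (m : X → X → X) (x y : X) : ℕ → X × X
  | 0 => (x, y)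
  | (i + 1) => (m (midSeq m x y i).1 (midSeq m x y i).2,
                m (midSeq m x y i).2 (midSeq m x y i).1)

open Filter Topology

section ConicalMidpoint

variable {X : Type*}

theorem midSeq_swap (m : X → X → X) (x y : X) (i : ℕ) :
    midSeq m y x i = (midSeq m x y i).swap := by
  induction i with
  | zero => rfl
  | succ i ih => simp [midSeq, ih]

variable [MetricSpace X] {m : X → X → X}

theorem IsConicalMidpoint.self (hm : IsConicalMidpoint m) (x : X) : m x x = x := by
  have h := hm.1 x x
  rw [dist_self, zero_div] at h
  exact (dist_eq_zero.1 h).symm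

theorem IsConicalMidpoint.dist_le (hm : IsConicalMidpoint m) (p x y : X) :
    dist p (m x y) ≤ (dist p x + dist p y) / 2 := by
  have h := hm.2.2 p p x y
  rw [hm.self] at h
  linarith

theorem IsConicalMidpoint.antitone_dist_add_dist (hm : IsConicalMidpoint m) (p x y : X) :
    Antitone fun i => dist p (midSeq m x y i).1 + dist p (midSeq m x y i).2 := by
  refine antitone_nat_of_succ_le fun i => ?_
  have h₁ := hm.dist_le p (midSeq m x y i).1 (midSeq m x y i).2
  have h₂ := hm.dist_le p (midSeq m x y i).2 (midSeq m x y i).1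
  simp only [midSeq]
  linarith

theorem IsConicalMidpoint.dist_midSeq_add_le (hm : IsConicalMidpoint m) (x y x' y' : X) (i : ℕ) :
    dist (midSeq m x y i).1 (midSeq m x' y' i).1 + dist (midSeq m x y i).2 (midSeq m x' y' i).2 ≤
      dist x x' + dist y y' := by
  induction i with
  | zero => exact le_rfl
  | succ i ih =>
    have h₁ := hm.2.2 (midSeq m x y i).1 (midSeq m x y i).2
      (midSeq m x' y' i).1 (midSeq m x' y' i).2
    have h₂ := hm.2.2 (midSeq m x y i).2 (midSeq m x y i).1
      (midSeq m x' y' i).2 (midSeq m x' y' i).1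
    simp only [midSeq]
    linarith

/-- For every point `p`, the distances from `p` to both iterated midpoint sequences converge to
the same limit. -/
theorem IsConicalMidpoint.exists_tendsto_dist (hm : IsConicalMidpoint m) (p x y : X) :
    ∃ r : ℝ, Tendsto (fun i => dist p (midSeq m x y i).1) atTop (𝓝 r) ∧
      Tendsto (fun i => dist p (midSeq m x y i).2) atTop (𝓝 r) := by
  set g : ℕ → ℝ := fun i => dist p (midSeq m x y i).1 + dist p (midSeq m x y i).2 with hg
  have hbdd : BddBelow (Set.range g) := ⟨0, by rintro _ ⟨i, rfl⟩; positivity⟩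
  have hlim : Tendsto g atTop (𝓝 (⨅ i, g i)) :=
    tendsto_atTop_ciInf (hm.antitone_dist_add_dist p x y) hbdd
  have hlim' : Tendsto (fun i => g (i + 1)) atTop (𝓝 (⨅ i, g i)) :=
    (tendsto_add_atTop_iff_nat 1).2 hlim
  have hupper : Tendsto (fun i => g i / 2) atTop (𝓝 ((⨅ i, g i) / 2)) := hlim.div_const 2
  have hlower : Tendsto (fun i => g (i + 1) - g i / 2) atTop (𝓝 ((⨅ i, g i) / 2)) := by
    simpa only [sub_half] using hlim'.sub hupper
  have h₁ (i : ℕ) : dist p (midSeq m x y (i + 1)).1 ≤ g i / 2 := hm.dist_le p _ _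
  have h₂ (i : ℕ) : dist p (midSeq m x y (i + 1)).2 ≤ g i / 2 :=
    (hm.dist_le p _ _).trans_eq (by rw [hg, add_comm])
  have hsum (i : ℕ) :
      g (i + 1) = dist p (midSeq m x y (i + 1)).1 + dist p (midSeq m x y (i + 1)).2 := rfl
  refine ⟨(⨅ i, g i) / 2, (tendsto_add_atTop_iff_nat 1).1 ?_, (tendsto_add_atTop_iff_nat 1).1 ?_⟩
  · exact tendsto_of_tendsto_of_tendsto_of_le_of_le hlower hupper
      (fun i => by linarith [h₂ i, hsum i]) h₁
  · exact tendsto_of_tendsto_of_tendsto_of_le_of_le hlower hupper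
      (fun i => by linarith [h₁ i, hsum i]) h₂

theorem IsConicalMidpoint.exists_tendsto_midSeq [ProperSpace X] (hm : IsConicalMidpoint m)
    (x y : X) :
    ∃ a : X, Tendsto (fun i => (midSeq m x y i).1) atTop (𝓝 a) ∧
      Tendsto (fun i => (midSeq m x y i).2) atTop (𝓝 a) := by
  have hmem (i : ℕ) : (midSeq m x y i).1 ∈ Metric.closedBall x (dist x y) := by
    have h : dist x (midSeq m x y i).1 + dist x (midSeq m x y i).2 ≤ dist x x + dist x y :=
      hm.antitone_dist_add_dist x x y (Nat.zero_le i)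
    rw [dist_self, zero_add] at h
    rw [Metric.mem_closedBall']
    linarith [dist_nonneg (x := x) (y := (midSeq m x y i).2)]
  obtain ⟨a, -, φ, hφ, ha⟩ := (isCompact_closedBall x (dist x y)).tendsto_subseq hmem
  obtain ⟨r, h₁, h₂⟩ := hm.exists_tendsto_dist a x y
  have hr : r = 0 := by
    have h := (tendsto_const_nhds (x := a)).dist ha
    rw [dist_self] at h
    exact tendsto_nhds_unique (h₁.comp hφ.tendsto_atTop) h
  subst hr
  simp only [dist_comm a] at h₁ h₂
  exact ⟨a, tendsto_iff_dist_tendsto_zero.2 h₁, tendsto_iff_dist_tendsto_zero.2 h₂⟩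

end ConicalMidpoint

/-- A proper metric space with a conical midpoint assignment admits a symmetric conical
midpoint assignment, obtained as the common limit of the iterated midpoint sequences. -/
theorem stmt4 {X : Type*} [MetricSpace X] [ProperSpace X]
    (m : X → X → X) (hm : IsConicalMidpoint m) :
    ∃ sq : X → X → X, IsConicalMidpoint sq ∧
      (∀ x y : X, sq x y = sq y x) ∧
      (∀ x y : X,
        Filter.Tendsto (fun i => (midSeq m x y i).1) Filter.atTop (nhds (sq x y)) ∧
        Filter.Tendsto (fun i => (midSeq m x y i).2) Filter.atTop (nhds (sq x y))) := by
  choose sq h₁ h₂ using hm.exists_tendsto_midSeq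
  have hdist (p x y : X) : 2 * dist p (sq x y) ≤ dist p x + dist p y := by
    rw [two_mul]
    exact le_of_tendsto' ((tendsto_const_nhds.dist (h₁ x y)).add
      (tendsto_const_nhds.dist (h₂ x y)))
      fun i => hm.antitone_dist_add_dist p x y (Nat.zero_le i)
  have hmid (x y : X) : dist x (sq x y) = dist x y / 2 ∧ dist (sq x y) y = dist x y / 2 := by
    have hx := hdist x x y
    have hy := hdist y x y
    rw [dist_self] at hx hy
    rw [dist_comm y x, dist_comm y (sq x y)] at hy
    have := dist_triangle x (sq x y) y
    constructor <;> linarith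
  refine ⟨sq, ⟨fun x y => (hmid x y).1, fun x y => (hmid x y).2, fun x y x' y' => ?_⟩,
    fun x y => ?_, fun x y => ⟨h₁ x y, h₂ x y⟩⟩
  · have h := le_of_tendsto' (((h₁ x y).dist (h₁ x' y')).add ((h₂ x y).dist (h₂ x' y')))
      (hm.dist_midSeq_add_le x y x' y')
    linarith
  · refine tendsto_nhds_unique (h₁ x y) ?_
    simpa only [midSeq_swap m x y, Prod.snd_swap] using h₂ y x
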